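/- arXiv:1501.06105 — 2 statements merged into one kernel-verified Lean document; each statement's English description precedes it below -/
import Mathlib

section
/- With W_n(z) defined as by the iterated-claw normalized recurrence (W_0=2(1+z), W_1=8(5+3z), W_2=16(3+45z+16z^2); W_n = 20z·W_{n-1} + 8(3-8z)·W_{n-2} - 384z^2·W_{n-3} for n even ≥ 4, W_n = 20·W_{n-1} + 8(3-8z)·W_{n-2} - 384z·W_{n-3} for n odd ≥ 3): for every n ≥ 1 the roots of W_n and W_{n-1} strictly interlace, namely x_{n,1} < x_{n-1,1} < x_{n,2} < x_{n-1,2} < ⋯, where W_n has one more root than W_{n-1} when n is even and the same number of roots when n is odd (W_n having d_n = ⌈(n+1)/2⌉ distinct negative real roots). -/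
open Polynomial

lemma seq_step {r S Qa Qb L : ℝ} (hr0 : 0 < r) (hr3 : r < 293/100) (hS : r * S = 384)
    (hQ : Qa ≠ 0) (hL : L ^ 2 ≤ 16 * Qa ^ 2) (h : Qb * Qa < 7 * Qa ^ 2) :
    L ^ 2 < Qb ^ 2 - (20 + r) * Qb * Qa + S * Qa ^ 2 := by
  have hQ2 : 0 < Qa ^ 2 := by positivity
  have hS1 : 131 < S := by
    by_contra hc
    push Not at hc
    nlinarith
  set m := Qb / Qa with hm
  have hmQ : Qb = m * Qa := by rw [hm]; field_simp
  have hm7 : m < 7 := by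
    rw [hmQ] at h
    by_contra hc
    push Not at hc
    nlinarith
  have : 16 < m ^ 2 - (20 + r) * m + S := by nlinarith [mul_pos (sub_pos.2 hm7) (sub_pos.2 hm7), mul_pos (sub_pos.2 hm7) (sub_pos.2 hr3)]
  rw [hmQ]
  nlinarith

lemma seq_concl1 {r S a b c : ℝ} (hr0 : 0 < r) (hr3 : r < 293/100) (hS : r * S = 384)
    (hb : b = 0)
    (h : (c - (20 + r) * b + S * a) ^ 2 < (c + r * b) ^ 2 - (20 + r) * (c + r * b) * (b + r * a) + S * (b + r * a) ^ 2) :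
    c * a < 0 := by
  subst hb
  have hS1 : 131 < S := by
    by_contra hc
    push Not at hc
    nlinarith
  by_contra hc
  push Not at hc
  have h1 : 0 ≤ S * (c * a) := by positivity
  have h2 : 0 ≤ r * (c * a) := by positivity
  have h3 : 0 ≤ r * (r * (c * a)) := by positivity
  have h4 : S * r ^ 2 * a ^ 2 ≤ S ^ 2 * a ^ 2 := by
    have : S * r ^ 2 ≤ S ^ 2 := by nlinarith
    exact mul_le_mul_of_nonneg_right this (sq_nonneg a)
  nlinarith

lemma seq_main (q : ℕ → ℝ) (b r S : ℝ) (hr0 : 0 < r) (hr3 : r < 293/100) (hS : r * S = 384)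
    (hb : b = S - r ^ 2 - 20 * r)
    (hrec : ∀ n, q (n + 3) = 20 * q (n + 2) - b * q (n + 1) - 384 * q n)
    (hinit : (q 1 + r * q 0 ≠ 0 ∧ (q 2 - (20 + r) * q 1 + S * q 0) ^ 2 ≤ 16 * (q 1 + r * q 0) ^ 2) ∨
      (q 2 - (20 + r) * q 1 + S * q 0) ^ 2 < (q 2 + r * q 1) ^ 2
        - (20 + r) * (q 2 + r * q 1) * (q 1 + r * q 0) + S * (q 1 + r * q 0) ^ 2) :
    ∀ n, q (n + 1) = 0 → q (n + 2) * q n < 0 := by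
  have hS1 : 131 < S := by
    by_contra hc
    push Not at hc
    nlinarith
  have key : ∀ n, (q (n+1) + r * q n ≠ 0 ∧ (q (n+2) - (20 + r) * q (n+1) + S * q n) ^ 2 ≤ 16 * (q (n+1) + r * q n) ^ 2) ∨
      (q (n+2) - (20 + r) * q (n+1) + S * q n) ^ 2 < (q (n+2) + r * q (n+1)) ^ 2
        - (20 + r) * (q (n+2) + r * q (n+1)) * (q (n+1) + r * q n) + S * (q (n+1) + r * q n) ^ 2 := by
    intro n
    induction n with
    | zero => simpa using hinit
    | succ n ih =>
      have hr := hrec n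
      have hL : q (n + 3) - (20 + r) * q (n + 2) + S * q (n + 1)
          = -r * (q (n+2) - (20 + r) * q (n+1) + S * q n) := by
        rw [hr, hb]; linear_combination q n * hS
      have hQ : q (n + 3) + r * q (n + 2) = (20 + r) * (q (n+2) + r * q (n+1)) - S * (q (n+1) + r * q n) := by
        rw [hr, hb]; linear_combination q n * hS
      have step2 : (q (n+2) - (20 + r) * q (n+1) + S * q n) ^ 2 < (q (n+2) + r * q (n+1)) ^ 2
        - (20 + r) * (q (n+2) + r * q (n+1)) * (q (n+1) + r * q n) + S * (q (n+1) + r * q n) ^ 2 →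
        (q (n + 3) - (20 + r) * q (n + 2) + S * q (n + 1)) ^ 2 < (q (n + 3) + r * q (n + 2)) ^ 2
        - (20 + r) * (q (n+3) + r * q (n+2)) * (q (n+2) + r * q (n+1)) + S * (q (n+2) + r * q (n+1)) ^ 2 := by
        intro h
        rw [hL, hQ]
        set Qa := q (n+1) + r * q n
        set Qb := q (n+2) + r * q (n+1)
        set L := q (n+2) - (20 + r) * q (n+1) + S * q n
        have h1 : r ^ 2 * L ^ 2 ≤ S * L ^ 2 :=
          mul_le_mul_of_nonneg_right (by nlinarith) (sq_nonneg L)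
        have h2 := mul_lt_mul_of_pos_left h (show 0 < S by linarith)
        nlinarith
      rcases ih with ⟨h1, h2⟩ | h
      · by_cases hc : (q (n+2) + r * q (n+1)) * (q (n+1) + r * q n) < 7 * (q (n+1) + r * q n) ^ 2
        · right
          exact step2 (seq_step hr0 hr3 hS h1 h2 hc)
        · left
          push Not at hc
          show q (n+2) + r * q (n+1) ≠ 0 ∧ (q (n + 3) - (20 + r) * q (n + 2) + S * q (n + 1)) ^ 2 ≤ _
          rw [hL]
          set Qa := q (n+1) + r * q n
          set Qb := q (n+2) + r * q (n+1)
          set L := q (n+2) - (20 + r) * q (n+1) + S * q n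
          have hQ2 : 0 < Qa ^ 2 := by positivity
          have h49 : 49 * Qa ^ 2 ≤ Qb ^ 2 := by nlinarith [sq_nonneg (Qb - 7 * Qa)]
          refine ⟨fun h => by rw [h] at h49; nlinarith, ?_⟩
          have : r ^ 2 * L ^ 2 ≤ 9 * L ^ 2 :=
            mul_le_mul_of_nonneg_right (by nlinarith) (sq_nonneg L)
          nlinarith
      · right; exact step2 h
  intro n hn
  rcases key n with ⟨h1, h2⟩ | h
  · by_cases hc : (q (n+2) + r * q (n+1)) * (q (n+1) + r * q n) < 7 * (q (n+1) + r * q n) ^ 2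
    · exact seq_concl1 hr0 hr3 hS hn (seq_step hr0 hr3 hS h1 h2 hc)
    · exfalso
      push Not at hc
      rw [hn] at h1 h2 hc
      simp only [mul_zero, zero_add, add_zero, sub_zero] at h1 h2 hc
      have ha : q n ≠ 0 := fun h => h1 (by rw [h]; simp)
      have ha2 : 0 < (q n) ^ 2 := by positivity
      have hca : 7 * r * q n ^ 2 ≤ q (n+2) * q n := by
        by_contra hcc
        push Not at hcc
        nlinarith
      have h5 : 0 ≤ q (n+2) * q n := le_trans (by positivity) hca
      have h6 : S ^ 2 * q n ^ 2 ≤ (q (n+2) + S * q n) ^ 2 := by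
        have : 0 ≤ S * (q (n+2) * q n) := by positivity
        nlinarith [sq_nonneg (q (n+2))]
      have h7 : 16 * r ^ 2 < S ^ 2 := by nlinarith
      nlinarith
  · exact seq_concl1 hr0 hr3 hS hn h

lemma exists_r {T : ℝ} (hT : 0 < T) : ∃ r : ℝ, 0 < r ∧ r < 293/100 ∧
    0 < 32 - 8 * r - r ^ 2 ∧ T * ((12 + r) * (32 - 8 * r - r ^ 2)) = 24 * r := by
  have hc : ContinuousOn (fun r : ℝ => T * ((12 + r) * (32 - 8 * r - r ^ 2)) - 24 * r) (Set.Icc 0 (293/100)) := by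
    fun_prop
  have := intermediate_value_Ioo' (by norm_num) hc
  obtain ⟨r, ⟨h1, h2⟩, h3⟩ := this (show (0:ℝ) ∈ _ from ⟨by norm_num; nlinarith, by norm_num; nlinarith⟩)
  simp only at h3
  refine ⟨r, h1, h2, ?_, by linarith⟩
  by_contra hcon
  push Not at hcon
  have : T * ((12 + r) * (32 - 8 * r - r ^ 2)) ≤ 0 :=
    mul_nonpos_of_nonneg_of_nonpos hT.le (mul_nonpos_of_nonneg_of_nonpos (by linarith) hcon)
  linarith

lemma poly_pos {r : ℝ} (hr0 : 0 < r) (hr : r ≤ 57/20) :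
    0 < (86973087744) * r ^ 0 + (-39862665216) * r ^ 1 + (-3586129920) * r ^ 2 + (2293235712) * r ^ 3 + (192872448) * r ^ 4 + (-36864000) * r ^ 5 + (-4976640) * r ^ 6 + (43008) * r ^ 7 + (4352) * r ^ 8 + (-12544) * r ^ 9 + (-2304) * r ^ 10 + (-160) * r ^ 11 + (-4) * r ^ 12 := by
  have h : 0 ≤ 57 - 20 * r := by linarith
  have e : 57 ^ 12 * ((86973087744) * r ^ 0 + (-39862665216) * r ^ 1 + (-3586129920) * r ^ 2 + (2293235712) * r ^ 3 + (192872448) * r ^ 4 + (-36864000) * r ^ 5 + (-4976640) * r ^ 6 + (43008) * r ^ 7 + (4352) * r ^ 8 + (-12544) * r ^ 9 + (-2304) * r ^ 10 + (-160) * r ^ 11 + (-4) * r ^ 12) =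
      86973087744 * (20 * r) ^ 0 * (57 - 20 * r) ^ 12
        + 4650342285312/5 * (20 * r) ^ 1 * (57 - 20 * r) ^ 11
        + 22307004481536/5 * (20 * r) ^ 2 * (57 - 20 * r) ^ 10
        + 1580926191058944/125 * (20 * r) ^ 3 * (57 - 20 * r) ^ 9
        + 14678741978373888/625 * (20 * r) ^ 4 * (57 - 20 * r) ^ 8
        + 18689015640770784/625 * (20 * r) ^ 5 * (57 - 20 * r) ^ 7
        + 82885543463174013/3125 * (20 * r) ^ 6 * (57 - 20 * r) ^ 6
        + 10184467799168716653/625000 * (20 * r) ^ 7 * (57 - 20 * r) ^ 5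
        + 674125177857517986417/100000000 * (20 * r) ^ 8 * (57 - 20 * r) ^ 4
        + 3539482627742244198567/2000000000 * (20 * r) ^ 9 * (57 - 20 * r) ^ 3
        + 10521476534197814411979/40000000000 * (20 * r) ^ 10 * (57 - 20 * r) ^ 2
        + 22414479574325472947223/1280000000000 * (20 * r) ^ 11 * (57 - 20 * r) ^ 1
        + 285918415324513562871999/1024000000000000 * (20 * r) ^ 12 * (57 - 20 * r) ^ 0 := by ring
  have p : 0 < (57:ℝ) ^ 12 * ((86973087744) * r ^ 0 + (-39862665216) * r ^ 1 + (-3586129920) * r ^ 2 + (2293235712) * r ^ 3 + (192872448) * r ^ 4 + (-36864000) * r ^ 5 + (-4976640) * r ^ 6 + (43008) * r ^ 7 + (4352) * r ^ 8 + (-12544) * r ^ 9 + (-2304) * r ^ 10 + (-160) * r ^ 11 + (-4) * r ^ 12) := by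
    rw [e]; positivity
  exact pos_of_mul_pos_right p (by positivity)

lemma init_small {T r : ℝ} (hT : 0 < T) (hr0 : 0 < r) (hr : r ≤ 57/20)
    (hD : 0 < 32 - 8 * r - r ^ 2) (h : T * ((12 + r) * (32 - 8 * r - r ^ 2)) = 24 * r)
    (q0 q1 q2 : ℝ) (h0 : q0 = 2 * (1 - T)) (h1 : q1 = 40 - 24 * T)
    (h2 : q2 = -16 * (3 - 45 * T + 16 * T ^ 2) / T) :
    (q2 - (20 + r) * q1 + 384 / r * q0) ^ 2 < (q2 + r * q1) ^ 2
        - (20 + r) * (q2 + r * q1) * (q1 + r * q0) + 384 / r * (q1 + r * q0) ^ 2 := by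
  have h12 : 0 < 12 + r := by linarith
  have hTe : T = 24 * r / ((12 + r) * (32 - 8 * r - r ^ 2)) := by
    rw [eq_div_iff (by positivity)]; exact h
  have key : (q2 + r * q1) ^ 2
        - (20 + r) * (q2 + r * q1) * (q1 + r * q0) + 384 / r * (q1 + r * q0) ^ 2
      - (q2 - (20 + r) * q1 + 384 / r * q0) ^ 2 =
      ((86973087744) * r ^ 0 + (-39862665216) * r ^ 1 + (-3586129920) * r ^ 2 + (2293235712) * r ^ 3 + (192872448) * r ^ 4 + (-36864000) * r ^ 5 + (-4976640) * r ^ 6 + (43008) * r ^ 7 + (4352) * r ^ 8 + (-12544) * r ^ 9 + (-2304) * r ^ 10 + (-160) * r ^ 11 + (-4) * r ^ 12) / (r * ((12 + r) * (32 - 8 * r - r ^ 2))) ^ 2 := by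
    have hne := hD.ne'
    rw [h0, h1, h2, hTe]
    clear hTe h hD
    generalize hg : 32 - 8 * r - r ^ 2 = D at *
    field_simp
    rw [← hg]
    ring
  have : 0 < ((86973087744) * r ^ 0 + (-39862665216) * r ^ 1 + (-3586129920) * r ^ 2 + (2293235712) * r ^ 3 + (192872448) * r ^ 4 + (-36864000) * r ^ 5 + (-4976640) * r ^ 6 + (43008) * r ^ 7 + (4352) * r ^ 8 + (-12544) * r ^ 9 + (-2304) * r ^ 10 + (-160) * r ^ 11 + (-4) * r ^ 12) / (r * ((12 + r) * (32 - 8 * r - r ^ 2))) ^ 2 :=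
    div_pos (poly_pos hr0 hr) (by positivity)
  linarith

lemma init_large {T r : ℝ} (hT : 0 < T) (hr : 57/20 < r) (hr3 : r < 293/100)
    (hD : 0 < 32 - 8 * r - r ^ 2) (h : T * ((12 + r) * (32 - 8 * r - r ^ 2)) = 24 * r)
    (q0 q1 q2 : ℝ) (h0 : q0 = 2 * (1 - T)) (h1 : q1 = 40 - 24 * T)
    (h2 : q2 = -16 * (3 - 45 * T + 16 * T ^ 2) / T) :
    q1 + r * q0 ≠ 0 ∧ (q2 - (20 + r) * q1 + 384 / r * q0) ^ 2 ≤ 16 * (q1 + r * q0) ^ 2 := by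
  have hr0 : 0 < r := by linarith
  have h12 : 0 < 12 + r := by linarith
  have hT4 : 4 ≤ T := by
    by_contra hc
    push Not at hc
    have a1 : (12 + r) * (32 - 8 * r - r ^ 2) ≤ 15 * 1.1 :=
      mul_le_mul (by linarith) (by nlinarith) hD.le (by norm_num)
    nlinarith
  have hTe : T = 24 * r / ((12 + r) * (32 - 8 * r - r ^ 2)) := by
    rw [eq_div_iff (by positivity)]; exact h
  have hL : q2 - (20 + r) * q1 + 384 / r * q0 = 2 * (r ^ 2 + 16 * T + 24 * r / (12 + r)) := by
    have hne := hD.ne'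
    rw [h0, h1, h2, hTe]
    clear hTe h hD
    generalize hg : 32 - 8 * r - r ^ 2 = D at *
    field_simp
    rw [← hg]
    ring
  have h5 : 24 * r / (12 + r) ≤ 6 := by
    rw [div_le_iff₀ h12]; linarith
  have h6 : 0 < 24 * r / (12 + r) := by positivity
  have hQ : q1 + r * q0 = -(24 * T - 40 + 2 * r * (T - 1)) := by rw [h0, h1]; ring
  have hQp : 118 * T - 183 ≤ 4 * (24 * T - 40 + 2 * r * (T - 1)) := by nlinarith
  have hLp : 2 * (r ^ 2 + 16 * T + 24 * r / (12 + r)) ≤ 32 * T + 30 := by nlinarith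
  rw [hL, hQ]
  refine ⟨by linarith, ?_⟩
  have h7 : 2 * (r ^ 2 + 16 * T + 24 * r / (12 + r)) ≤ 4 * (24 * T - 40 + 2 * r * (T - 1)) := by
    linarith
  have h8 : 0 ≤ 2 * (r ^ 2 + 16 * T + 24 * r / (12 + r)) := by positivity
  have := pow_le_pow_left₀ h8 h7 2
  linarith

lemma eval_sign (W : ℕ → Polynomial ℝ)
    (h0 : W 0 = 2 * (1 + X)) (h1 : W 1 = 8 * (5 + 3 * X))
    (h2 : W 2 = 16 * (3 + 45 * X + 16 * X ^ 2))
    (hrec : ∀ n, (Even (n + 3) → W (n + 3) =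
        20 * X * W (n + 2) + 8 * (3 - 8 * X) * W (n + 1) - 384 * X ^ 2 * W n) ∧
      (Odd (n + 3) → W (n + 3) =
        20 * W (n + 2) + 8 * (3 - 8 * X) * W (n + 1) - 384 * X * W n))
    (n : ℕ) (z : ℝ) (hz : z < 0) (hroot : (W (n + 1)).eval z = 0) :
    0 < (W (n + 2)).eval z * (W n).eval z := by
  obtain ⟨r, hr0, hr3, hD, h⟩ := exists_r (T := -z) (by linarith)
  have hz0 : z ≠ 0 := hz.ne
  have h12 : 0 < 12 + r := by linarith
  let q : ℕ → ℝ := fun n => (W n).eval z / z ^ (n / 2)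
  have hqrec : ∀ n, q (n + 3) = 20 * q (n + 2) - (64 - 24 / z) * q (n + 1) - 384 * q n := by
    intro n
    rcases Nat.even_or_odd' n with ⟨k, rfl | rfl⟩
    · have hodd : Odd (2 * k + 3) := ⟨k + 1, by ring⟩
      simp only [q, (hrec (2 * k)).2 hodd]
      have e1 : (2 * k + 3) / 2 = k + 1 := by omega
      have e2 : (2 * k + 2) / 2 = k + 1 := by omega
      have e3 : (2 * k + 1) / 2 = k := by omega
      have e4 : (2 * k) / 2 = k := by omega
      rw [e1, e2, e3, e4]
      simp
      field_simp
      ring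
    · have hev : Even (2 * k + 1 + 3) := ⟨k + 2, by ring⟩
      simp only [q, (hrec (2 * k + 1)).1 hev]
      have e1 : (2 * k + 1 + 3) / 2 = k + 2 := by omega
      have e2 : (2 * k + 1 + 2) / 2 = k + 1 := by omega
      have e3 : (2 * k + 1 + 1) / 2 = k + 1 := by omega
      have e4 : (2 * k + 1) / 2 = k := by omega
      rw [e1, e2, e3, e4]
      simp
      field_simp
      ring
  have q0 : q 0 = 2 * (1 - (-z)) := by simp [q, h0]
  have q1 : q 1 = 40 - 24 * (-z) := by simp [q, h1]; ring
  have q2 : q 2 = -16 * (3 - 45 * (-z) + 16 * (-z) ^ 2) / (-z) := by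
    simp [q, h2]
  have hb : 64 - 24 / z = 384 / r - r ^ 2 - 20 * r := by
    field_simp
    linear_combination h
  have main := seq_main q (64 - 24 / z) r (384 / r) hr0 hr3 (by field_simp) hb hqrec (by
    by_cases hc : r ≤ 57/20
    · right; exact init_small (T := -z) (by linarith) hr0 hc hD h _ _ _ q0 q1 q2
    · left; push Not at hc
      exact init_large (T := -z) (by linarith) hc hr3 hD h _ _ _ q0 q1 q2) n
    (by simp [q, hroot])
  have ew : ∀ m, (W m).eval z = q m * z ^ (m / 2) := by
    intro m; simp only [q]; field_simp
  have e : (n + 2) / 2 = n / 2 + 1 := by omega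
  rw [ew, ew, e]
  have : q (n + 2) * z ^ (n / 2 + 1) * (q n * z ^ (n / 2)) = (-(q (n + 2) * q n)) * (-z) * (z ^ (n / 2)) ^ 2 := by
    ring
  rw [this]
  have hp : 0 < (z ^ (n / 2)) ^ 2 := by positivity
  exact mul_pos (mul_pos (by linarith) (by linarith)) hp

lemma roots_of_signs (P : ℝ[X]) (m : ℕ) (hdeg : P.natDegree = m) (s : ℝ) (p : ℕ → ℝ)
    (hp : ∀ i < m, p i < p (i + 1)) (hs : ∀ i ≤ m, 0 < s * (-1) ^ i * P.eval (p i)) :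
    ∃ r : ℕ → ℝ, (∀ i < m, p i < r i ∧ r i < p (i + 1)) ∧
      P = C P.leadingCoeff * ∏ i ∈ Finset.range m, (X - C (r i)) := by
  have h1 : ∀ i, ∃ x, i < m → (p i < x ∧ x < p (i + 1)) ∧ P.eval x = 0 := by
    intro i
    by_cases hi : i < m
    · have a := hs i hi.le
      have b := hs (i + 1) hi
      have hc : ContinuousOn (fun x => s * (-1) ^ i * P.eval x) (Set.Icc (p i) (p (i + 1))) := by
        fun_prop
      obtain ⟨x, hx, hx0⟩ := intermediate_value_Ioo' (hp i hi).le hc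
        (show (0:ℝ) ∈ _ from ⟨by rw [pow_succ] at b; linarith, a⟩)
      refine ⟨x, fun _ => ⟨hx, ?_⟩⟩
      have hne : s * (-1) ^ i ≠ 0 := fun h => by rw [h] at a; simp at a
      exact (mul_eq_zero.1 hx0).resolve_left hne
    · exact ⟨0, fun h => absurd h hi⟩
  choose r hr using h1
  refine ⟨r, fun i hi => (hr i hi).1, ?_⟩
  have hP : P ≠ 0 := by
    rintro rfl
    have := hs 0 (Nat.zero_le _)
    simp at this
  have hlt : ∀ j, ∀ i < j, j < m → r i < r j := by
    intro j
    induction j with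
    | zero => intro i hi; omega
    | succ j ih =>
      intro i hi hj
      have h1 : r j < r (j + 1) := lt_trans (hr j (by omega)).1.2 (hr (j + 1) hj).1.1
      rcases Nat.lt_succ_iff_lt_or_eq.1 hi with h | h
      · exact lt_trans (ih i h (by omega)) h1
      · subst h; exact h1
  have hinj : Set.InjOn r (Finset.range m : Set ℕ) := by
    intro i hi j hj hij
    simp at hi hj
    rcases lt_trichotomy i j with h | h | h
    · exact absurd hij (hlt j i h hj).ne
    · exact h
    · exact absurd hij (hlt i j h hi).ne'
  have hle : ((Finset.range m).image r).val ≤ P.roots := by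
    rw [Finset.val_le_iff_val_subset]
    intro x hx
    simp only [Finset.mem_val, Finset.mem_image, Finset.mem_range] at hx
    obtain ⟨i, hi, rfl⟩ := hx
    rw [mem_roots hP]
    exact (hr i hi).2
  have hcard : ((Finset.range m).image r).card = m := by
    rw [Finset.card_image_of_injOn hinj, Finset.card_range]
  have heq : ((Finset.range m).image r).val = P.roots := by
    apply Multiset.eq_of_le_of_card_le hle
    rw [Finset.card_val, hcard, ← hdeg]
    exact P.card_roots'
  have hfin := C_leadingCoeff_mul_prod_multiset_X_sub_C (p := P) (by
    rw [← heq, Finset.card_val, hcard, hdeg])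
  rw [← heq] at hfin
  conv_lhs => rw [← hfin]
  congr 1
  exact Finset.prod_image (g := r) (f := fun a => X - C a) hinj

lemma prod_sign (y : ℕ → ℝ) (t : ℝ) (d i : ℕ) (hi : i ≤ d) (h1 : ∀ j < i, y j < t)
    (h2 : ∀ j, i ≤ j → j < d → t < y j) :
    0 < (-1) ^ (d + i) * ∏ j ∈ Finset.range d, (t - y j) := by
  induction d, hi using Nat.le_induction with
  | base =>
    rw [← two_mul, pow_mul]
    simp only [even_two, Even.neg_pow, one_pow, one_mul]
    exact Finset.prod_pos fun j hj => sub_pos.2 (h1 j (Finset.mem_range.1 hj))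
  | succ d hd ih =>
    have ih := ih fun j a b => h2 j a (by omega)
    have := h2 d hd (by omega)
    rw [Finset.prod_range_succ]
    have e : (-1 : ℝ) ^ (d + 1 + i) * ((∏ j ∈ Finset.range d, (t - y j)) * (t - y d))
      = ((-1) ^ (d + i) * ∏ j ∈ Finset.range d, (t - y j)) * (y d - t) := by ring
    rw [e]
    exact mul_pos ih (by linarith)

lemma left_sign (P : ℝ[X]) (m : ℕ) (hm : 0 < m) (hdeg : P.natDegree = m)
    (hl : 0 < P.leadingCoeff) (B : ℝ) : ∃ M < B, 0 < (-1) ^ m * P.eval M := by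
  have hQ : (C ((-1 : ℝ) ^ m) * P.comp (-X)).leadingCoeff = P.leadingCoeff := by
    rw [leadingCoeff_mul, leadingCoeff_C, comp_neg_X_leadingCoeff_eq, hdeg, ← mul_assoc, ← pow_add,
      ← two_mul, pow_mul]
    simp
  have hd : 0 < (C ((-1 : ℝ) ^ m) * P.comp (-X)).degree := by
    rw [← natDegree_pos_iff_degree_pos, natDegree_C_mul (by positivity), natDegree_comp]
    simp [hdeg, hm]
  have ht := tendsto_atTop_of_leadingCoeff_nonneg _ hd (by rw [hQ]; exact hl.le)
  obtain ⟨M, h1, h2⟩ := ((ht.eventually_gt_atTop 0).and (Filter.eventually_gt_atTop (-B))).exists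
  refine ⟨-M, by linarith, ?_⟩
  simpa using h1

lemma enum_unique (d : ℕ) (f g : ℕ → ℝ) (hf : ∀ i j, i < j → j < d → f i < f j)
    (hg : ∀ i j, i < j → j < d → g i < g j)
    (h : (Finset.range d).image f = (Finset.range d).image g) : ∀ i < d, f i = g i := by
  have hF : StrictMono (fun i : Fin d => f i) := fun i j hij => hf i j hij j.2
  have hG : StrictMono (fun i : Fin d => g i) := fun i j hij => hg i j hij j.2
  have hr : Set.range (fun i : Fin d => f i) = Set.range (fun i : Fin d => g i) := by
    ext x
    have := Finset.ext_iff.1 h x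
    simp only [Finset.mem_image, Finset.mem_range] at this
    simp only [Set.mem_range, Fin.exists_iff]
    simpa using this
  have := (hF.range_inj hG).1 hr
  intro i hi
  exact congrFun this ⟨i, hi⟩

lemma W_facts (W : ℕ → Polynomial ℝ)
    (h0 : W 0 = 2 * (1 + X)) (h1 : W 1 = 8 * (5 + 3 * X))
    (h2 : W 2 = 16 * (3 + 45 * X + 16 * X ^ 2))
    (hrec : ∀ n, (Even (n + 3) → W (n + 3) =
        20 * X * W (n + 2) + 8 * (3 - 8 * X) * W (n + 1) - 384 * X ^ 2 * W n) ∧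
      (Odd (n + 3) → W (n + 3) =
        20 * W (n + 2) + 8 * (3 - 8 * X) * W (n + 1) - 384 * X * W n)) :
    ∀ n, 0 < (W n).eval 0 ∧ (W n).natDegree = (n + 2) / 2 ∧ 0 < (W n).leadingCoeff := by
  have hev0 : ∀ n, 0 < (W n).eval 0 ∧ 0 < (W (n + 1)).eval 0 ∧ 0 < (W (n + 2)).eval 0 := by
    intro n
    induction n with
    | zero => rw [h0, h1, h2]; simp
    | succ n ih =>
      refine ⟨ih.2.1, ih.2.2, ?_⟩
      show 0 < (W (n + 3)).eval 0
      rcases Nat.even_or_odd (n + 3) with h | h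
      · rw [(hrec n).1 h]; simp; linarith [ih.2.1]
      · rw [(hrec n).2 h]; simp; linarith [ih.2.1, ih.2.2]
  -- degree bounds and top coefficients
  have hdeg : ∀ n, (W n).natDegree ≤ (n + 2) / 2 ∧ (W (n + 1)).natDegree ≤ (n + 3) / 2 ∧
      (W (n + 2)).natDegree ≤ (n + 4) / 2 := by
    intro n
    induction n with
    | zero =>
      rw [h0, h1, h2]
      refine ⟨?_, ?_, ?_⟩ <;> norm_num <;> compute_degree
    | succ n ih =>
      refine ⟨ih.2.1, ih.2.2, ?_⟩
      show (W (n + 3)).natDegree ≤ (n + 5) / 2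
      obtain ⟨a, b, c⟩ := ih
      have e8 : (8 * (3 - 8 * X) : ℝ[X]).natDegree ≤ 1 := by compute_degree
      have e3 : (384 * X ^ 2 : ℝ[X]).natDegree ≤ 2 := by compute_degree
      have e4 : (384 * X : ℝ[X]).natDegree ≤ 1 := by compute_degree
      have e2 : (20 * X : ℝ[X]).natDegree ≤ 1 := by compute_degree
      have e1 : (20 : ℝ[X]).natDegree ≤ 0 := by compute_degree
      rcases Nat.even_or_odd' n with ⟨k, hk | hk⟩
      · rw [(hrec n).2 ⟨k + 1, by omega⟩]
        refine (natDegree_sub_le_of_le (natDegree_add_le_of_le (natDegree_mul_le_of_le e1 c)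
          (natDegree_mul_le_of_le e8 b)) (natDegree_mul_le_of_le e4 a)).trans ?_
        simp only [max_le_iff]; omega
      · rw [(hrec n).1 ⟨k + 2, by omega⟩]
        refine (natDegree_sub_le_of_le (natDegree_add_le_of_le (natDegree_mul_le_of_le e2 c)
          (natDegree_mul_le_of_le e8 b)) (natDegree_mul_le_of_le e3 a)).trans ?_
        simp only [max_le_iff]; omega
  let w : ℕ → ℝ := fun n => (W n).coeff ((n + 2) / 2)
  have hz : ∀ n j, (n + 2) / 2 < j → (W n).coeff j = 0 := fun n j hj =>
    coeff_eq_zero_of_natDegree_lt (lt_of_le_of_lt (hdeg n).1 hj)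
  have w0 : w 0 = 2 := by simp [w, h0, mul_add, coeff_X]
  have w1 : w 1 = 24 := by
    have : W 1 = C 40 + C 24 * X := by rw [h1]; simp only [map_ofNat]; ring
    simp [w, this, coeff_X, coeff_C]
  have w2 : w 2 = 256 := by
    have : W 2 = C 48 + C 720 * X + C 256 * X ^ 2 := by rw [h2]; simp only [map_ofNat]; ring
    simp [w, this, coeff_X, coeff_C]
  have wrec : ∀ n, w (n + 3) = 20 * w (n + 2) - 64 * w (n + 1) - 384 * w n := by
    intro n
    rcases Nat.even_or_odd' n with ⟨k, rfl | rfl⟩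
    · have e1 : (2 * k + 3 + 2) / 2 = k + 2 := by omega
      have e2 : (2 * k + 2 + 2) / 2 = k + 2 := by omega
      have e3 : (2 * k + 1 + 2) / 2 = k + 1 := by omega
      have e4 : (2 * k + 2) / 2 = k + 1 := by omega
      have hW : W (2 * k + 3) = C 20 * W (2 * k + 2) + C 24 * W (2 * k + 1)
          - C 64 * (W (2 * k + 1) * X) - C 384 * (W (2 * k) * X) := by
        rw [(hrec (2 * k)).2 ⟨k + 1, by ring⟩]; simp only [map_ofNat]; ring
      simp only [w, e1, e2, e3, e4, hW, coeff_add, coeff_sub, coeff_C_mul]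
      rw [show k + 2 = (k + 1) + 1 from rfl, coeff_mul_X, coeff_mul_X, hz (2 * k + 1) _ (by omega)]
      ring
    · have e1 : (2 * k + 1 + 3 + 2) / 2 = k + 3 := by omega
      have e2 : (2 * k + 1 + 2 + 2) / 2 = k + 2 := by omega
      have e3 : (2 * k + 1 + 1 + 2) / 2 = k + 2 := by omega
      have e4 : (2 * k + 1 + 2) / 2 = k + 1 := by omega
      have hW : W (2 * k + 1 + 3) = C 20 * (W (2 * k + 1 + 2) * X) + C 24 * W (2 * k + 1 + 1)
          - C 64 * (W (2 * k + 1 + 1) * X) - C 384 * (W (2 * k + 1) * X * X) := by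
        rw [(hrec (2 * k + 1)).1 ⟨k + 2, by ring⟩]; simp only [map_ofNat]; ring
      simp only [w, e1, e2, e3, e4, hW, coeff_add, coeff_sub, coeff_C_mul]
      rw [show k + 3 = (k + 1) + 1 + 1 from rfl, coeff_mul_X, coeff_mul_X, coeff_mul_X, coeff_mul_X,
        hz (2 * k + 1 + 1) _ (by omega)]
      ring
  have wpos : ∀ n, 0 < w n ∧ 0 < w (n + 1) ∧ w (n + 2) = 8 * w (n + 1) + 32 * w n := by
    intro n
    induction n with
    | zero => simp only [zero_add, w0, w1, w2]; norm_num
    | succ n ih =>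
      obtain ⟨a, b, c⟩ := ih
      refine ⟨b, by show 0 < w (n + 2); rw [c]; positivity, ?_⟩
      show w (n + 3) = 8 * w (n + 2) + 32 * w (n + 1)
      rw [wrec]; linarith
  intro n
  have hn : (W n).natDegree = (n + 2) / 2 :=
    natDegree_eq_of_le_of_coeff_ne_zero (hdeg n).1 (wpos n).1.ne'
  refine ⟨(hev0 n).1, hn, ?_⟩
  rw [leadingCoeff, hn]
  exact (wpos n).1

lemma inv (W : ℕ → Polynomial ℝ)
    (h0 : W 0 = 2 * (1 + X)) (h1 : W 1 = 8 * (5 + 3 * X))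
    (h2 : W 2 = 16 * (3 + 45 * X + 16 * X ^ 2))
    (hrec : ∀ n, (Even (n + 3) → W (n + 3) =
        20 * X * W (n + 2) + 8 * (3 - 8 * X) * W (n + 1) - 384 * X ^ 2 * W n) ∧
      (Odd (n + 3) → W (n + 3) =
        20 * W (n + 2) + 8 * (3 - 8 * X) * W (n + 1) - 384 * X * W n)) :
    ∀ n, ∃ x y : ℕ → ℝ,
      W (n + 1) = C (W (n + 1)).leadingCoeff * ∏ i ∈ Finset.range ((n + 3) / 2), (X - C (x i)) ∧
      W n = C (W n).leadingCoeff * ∏ i ∈ Finset.range ((n + 2) / 2), (X - C (y i)) ∧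
      (∀ i < (n + 3) / 2, x i < 0) ∧
      (∀ i j, i < j → j < (n + 3) / 2 → x i < x j) ∧
      (∀ i j, i < j → j < (n + 2) / 2 → y i < y j) ∧
      (∀ i < (n + 2) / 2, x i < y i) ∧
      (∀ i, i + 1 < (n + 3) / 2 → y i < x (i + 1)) := by
  have facts := W_facts W h0 h1 h2 hrec
  intro n
  induction n with
  | zero =>
    refine ⟨fun _ => -5/3, fun _ => -1, ?_, ?_, ?_, ?_, ?_, ?_, ?_⟩
    · have e : W 1 = C 24 * (X - C (-5/3)) := by
        rw [h1, mul_sub, ← C_mul, show (24 * (-5/3) : ℝ) = -40 by norm_num, C_neg]; simp only [map_ofNat]; ring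
      have l : (W 1).leadingCoeff = 24 := by rw [e, leadingCoeff_mul, leadingCoeff_C, leadingCoeff_X_sub_C, mul_one]
      simp only [zero_add] at *
      rw [l]; simpa using e
    · have e : W 0 = C 2 * (X - C (-1)) := by
        rw [h0, mul_sub, ← C_mul, show (2 * (-1) : ℝ) = -2 by norm_num, C_neg]; simp only [map_ofNat]; ring
      have l : (W 0).leadingCoeff = 2 := by rw [e, leadingCoeff_mul, leadingCoeff_C, leadingCoeff_X_sub_C, mul_one]
      rw [l]; simpa using e
    · intro i _; norm_num
    · intro i j a b; omega
    · intro i j a b; omega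
    · intro i _; norm_num
    · intro i a; omega
  | succ n ih =>
    obtain ⟨x, y, hx, hy, hneg, hxm, hym, hxy, hyx⟩ := ih
    set e := (n + 2) / 2 with he
    set d := (n + 3) / 2 with hd
    have hde : d = e ∨ d = e + 1 := by omega
    have hm : (n + 4) / 2 = e + 1 := by omega
    obtain ⟨f0, f1, f2⟩ := facts (n + 2)
    rw [show n + 2 + 2 = n + 4 from rfl, hm] at f1
    obtain ⟨M, hM, hMs⟩ := left_sign (W (n + 2)) (e + 1) (by omega) f1 f2 (x 0)
    have hsx : ∀ i < d, 0 < (-1) ^ (e + i) * (W (n + 2)).eval (x i) := by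
      intro i hi
      have hroot : (W (n + 1)).eval (x i) = 0 := by
        rw [hx, eval_mul, eval_prod, Finset.prod_eq_zero (Finset.mem_range.2 hi) (by simp), mul_zero]
      have hpos := eval_sign W h0 h1 h2 hrec n (x i) (hneg i hi) hroot
      have hs := prod_sign y (x i) e i (by omega) (fun j hj => by
          have h1 := hyx j (by omega)
          rcases Nat.lt_or_ge (j + 1) i with h | h
          · exact h1.trans (hxm _ _ h hi)
          · rwa [show j + 1 = i by omega] at h1) (fun j hj hj2 => by
          have h1 := hxy j hj2
          rcases Nat.lt_or_ge i j with h | h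
          · exact (hxm _ _ h (by omega)).trans h1
          · rw [show j = i by omega] at h1 ⊢; exact h1)
      have hWn : (W n).eval (x i) = (W n).leadingCoeff * ∏ j ∈ Finset.range e, (x i - y j) := by
        conv_lhs => rw [hy]
        simp [eval_prod]
      have h5 : 0 < (-1) ^ (e + i) * (W n).eval (x i) := by
        rw [hWn]
        have := mul_pos (facts n).2.2 hs
        linarith
      have h6 := mul_pos h5 hpos
      have h7 : 0 < ((-1) ^ (e + i) * (W (n + 2)).eval (x i)) * ((W n).eval (x i)) ^ 2 := by
        linarith
      exact pos_of_mul_pos_left h7 (sq_nonneg _)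
    let p : ℕ → ℝ := fun i => if i = 0 then M else if i ≤ d then x (i - 1) else 0
    have p0 : p 0 = M := by simp [p]
    have ps : ∀ i < d, p (i + 1) = x i := by
      intro i hi
      simp [p, Nat.succ_le_of_lt hi]
    have pd : p (d + 1) = 0 := by simp [p]
    have hd1 : 0 < d := by omega
    obtain ⟨r, hr, hprod⟩ := roots_of_signs (W (n + 2)) (e + 1) f1 ((-1) ^ (e + 1)) p (by
        intro i hi
        rcases i with _ | i
        · rw [p0, ps 0 hd1]; exact hM
        · rw [ps i (by omega)]
          rcases Nat.lt_or_ge (i + 1) d with h | h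
          · rw [ps _ h]; exact hxm _ _ (by omega) h
          · rw [show i + 1 + 1 = d + 1 by omega, pd]; exact hneg i (by omega)) (by
        intro i hi
        rcases i with _ | i
        · rw [p0]; simpa using hMs
        · rcases Nat.lt_or_ge i d with h | h
          · rw [ps i h]
            have := hsx i h
            have e2 : (-1 : ℝ) ^ (e + 1) * (-1) ^ (i + 1) = (-1) ^ (e + i) := by ring
            rwa [e2]
          · have h3 : i = d := by omega
            have h4 : d = e := by omega
            rw [h3, pd, h4, ← pow_add, ← two_mul, pow_mul]
            simpa using f0)
    refine ⟨r, x, ?_, hx, ?_, ?_, hxm, ?_, ?_⟩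
    · show W (n + 2) = C (W (n + 2)).leadingCoeff * ∏ i ∈ Finset.range ((n + 4) / 2), (X - C (r i))
      rw [hm]; exact hprod
    · intro i hi
      have hi' : i < e + 1 := by omega
      refine (hr i hi').2.trans_le ?_
      rcases Nat.lt_or_ge i d with h | h
      · rw [ps i h]; exact (hneg i h).le
      · rw [show i = d by omega, pd]
    · intro i j hij hj
      have h1 := (hr i (by omega)).2
      have h2 := (hr j (by omega)).1
      obtain ⟨j, rfl⟩ : ∃ k, j = k + 1 := ⟨j - 1, by omega⟩
      rw [ps i (by omega)] at h1
      rw [ps j (by omega)] at h2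
      refine h1.trans (lt_of_le_of_lt ?_ h2)
      rcases Nat.lt_or_ge i j with h | h
      · exact (hxm _ _ h (by omega)).le
      · rw [show i = j by omega]
    · intro i hi
      have hi' : i < d := by omega
      have := (hr i (by omega)).2
      rwa [ps i hi'] at this
    · intro i hi
      have := (hr (i + 1) (by omega)).1
      rwa [ps i (by omega)] at this

lemma roots_image (P : ℝ[X]) (hP : P ≠ 0) (d : ℕ) (f : ℕ → ℝ)
    (h : P = C P.leadingCoeff * ∏ i ∈ Finset.range d, (X - C (f i))) :
    P.roots.toFinset = (Finset.range d).image f := by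
  ext t
  rw [Multiset.mem_toFinset, mem_roots hP, IsRoot, h]
  have : P.leadingCoeff ≠ 0 := leadingCoeff_ne_zero.2 hP
  simp only [eval_mul, eval_C, eval_prod, mul_eq_zero, this, false_or, Finset.prod_eq_zero_iff,
    Finset.mem_image, eval_sub, eval_X, sub_eq_zero]
  simp only [eq_comm]

lemma image_shift (d : ℕ) (f : ℕ → ℝ) :
    (Finset.Icc 1 d).image f = (Finset.range d).image (fun i => f (i + 1)) := by
  ext t
  simp only [Finset.mem_image, Finset.mem_Icc, Finset.mem_range]
  constructor
  · rintro ⟨i, ⟨h1, h2⟩, rfl⟩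
    exact ⟨i - 1, by omega, by rw [Nat.sub_add_cancel h1]⟩
  · rintro ⟨i, h, rfl⟩
    exact ⟨i + 1, ⟨by omega, by omega⟩, rfl⟩

theorem stmt13 (W : ℕ → Polynomial ℝ)
    (h0 : W 0 = 2 * (1 + X)) (h1 : W 1 = 8 * (5 + 3 * X))
    (h2 : W 2 = 16 * (3 + 45 * X + 16 * X ^ 2))
    (hrec : ∀ n, (Even (n + 3) → W (n + 3) =
        20 * X * W (n + 2) + 8 * (3 - 8 * X) * W (n + 1) - 384 * X ^ 2 * W n) ∧
      (Odd (n + 3) → W (n + 3) =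
        20 * W (n + 2) + 8 * (3 - 8 * X) * W (n + 1) - 384 * X * W n)) :
    ∀ n, 1 ≤ n → ∀ x y : ℕ → ℝ,
      (∀ i j, 1 ≤ i → i < j → j ≤ (n + 2) / 2 → x i < x j) →
      (∀ i j, 1 ≤ i → i < j → j ≤ (n + 1) / 2 → y i < y j) →
      (∀ i, 1 ≤ i → i ≤ (n + 2) / 2 → x i < 0) →
      (∀ i, 1 ≤ i → i ≤ (n + 1) / 2 → y i < 0) →
      (W n).roots.card = (n + 2) / 2 →
      (W (n - 1)).roots.card = (n + 1) / 2 →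
      (W n).roots.toFinset = Finset.image x (Finset.Icc 1 ((n + 2) / 2)) →
      (W (n - 1)).roots.toFinset = Finset.image y (Finset.Icc 1 ((n + 1) / 2)) →
      (∀ i, 1 ≤ i → i ≤ (n + 1) / 2 → x i < y i) ∧
      (∀ i, 1 ≤ i → i + 1 ≤ (n + 2) / 2 → y i < x (i + 1)) := by

  intro n hn x y hx hy _ _ _ _ hxi hyi
  obtain ⟨k, rfl⟩ : ∃ k, n = k + 1 := ⟨n - 1, by omega⟩
  obtain ⟨x', y', hx', hy', -, hxm, hym, hxy, hyx⟩ := inv W h0 h1 h2 hrec k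
  have facts := W_facts W h0 h1 h2 hrec
  have hne : ∀ m, W m ≠ 0 := fun m h => by
    have := (facts m).1
    rw [h] at this
    simp at this
  rw [show k + 1 - 1 = k from rfl] at hyi
  rw [roots_image _ (hne _) _ _ hx', image_shift] at hxi
  rw [roots_image _ (hne _) _ _ hy', image_shift] at hyi
  have ex := enum_unique _ _ _ hxm (fun i j a b => hx (i + 1) (j + 1) (by omega) (by omega) (by omega)) hxi
  have ey := enum_unique _ _ _ hym (fun i j a b => hy (i + 1) (j + 1) (by omega) (by omega) (by omega)) hyi
  constructor
  · intro i hi1 hi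
    have h := hxy (i - 1) (by omega)
    rw [ex _ (by omega), ey _ (by omega), Nat.sub_add_cancel hi1] at h
    exact h
  · intro i hi1 hi
    have h := hyx (i - 1) (by omega)
    rw [ex _ (by omega), ey _ (by omega), Nat.sub_add_cancel hi1] at h
    exact h
end

section
/- Let Γ_n(z) be defined by Γ_0(z)=2+2z, Γ_1(z)=40z+24z^2, Γ_2(z)=48z+720z^2+256z^3, and Γ_n(z) = 20z·Γ_{n-1}(z) + 8z(3-8z)·Γ_{n-2}(z) - 384z^3·Γ_{n-3}(z) for n≥3. Then for every n ≥ 0 the coefficient sequence of Γ_n is log-concave: writing Γ_n(z) = Σ_i g(n,i) z^i, one has g(n,i-1)·g(n,i+1) ≤ g(n,i)^2 for all i ≥ 1. -/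
open Polynomial

/-- Generalized synchronisation relation between two coefficient sequences. -/
def SR (s : ℤ) (f g : ℤ → ℝ) : Prop :=
  ∀ p q : ℤ, p ≤ q + s → f (p - 1) * g (q + 1) ≤ f p * g q

/-- Multiplication by the variable. -/
def sh (f : ℤ → ℝ) : ℤ → ℝ := fun k => f (k - 1)

lemma SR.mono {s t : ℤ} {f g : ℤ → ℝ} (h : SR s f g) (hst : t ≤ s) : SR t f g :=
  fun p q hpq => h p q (by omega)

lemma SR.addL {s : ℤ} {f f' g : ℤ → ℝ} (h : SR s f g) (h' : SR s f' g) : SR s (f + f') g := by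
  intro p q hpq
  have := h p q hpq
  have := h' p q hpq
  simp only [Pi.add_apply]
  linarith

lemma SR.addR {s : ℤ} {f g g' : ℤ → ℝ} (h : SR s f g) (h' : SR s f g') : SR s f (g + g') := by
  intro p q hpq
  have := h p q hpq
  have := h' p q hpq
  simp only [Pi.add_apply]
  linarith

lemma SR.smulL {s : ℤ} {f g : ℤ → ℝ} (c : ℝ) (hc : 0 ≤ c) (h : SR s f g) : SR s (c • f) g := by
  intro p q hpq
  have := mul_le_mul_of_nonneg_left (h p q hpq) hc
  simp only [Pi.smul_apply, smul_eq_mul]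
  linarith

lemma SR.smulR {s : ℤ} {f g : ℤ → ℝ} (c : ℝ) (hc : 0 ≤ c) (h : SR s f g) : SR s f (c • g) := by
  intro p q hpq
  have := mul_le_mul_of_nonneg_left (h p q hpq) hc
  simp only [Pi.smul_apply, smul_eq_mul]
  linarith

lemma SR.shL {s t : ℤ} {f g : ℤ → ℝ} (h : SR t f g) (hst : s - 1 ≤ t) : SR s (sh f) g :=
  fun p q hpq => h (p - 1) q (by omega)

lemma SR.shR {s t : ℤ} {f g : ℤ → ℝ} (h : SR t f g) (hst : s + 1 ≤ t) : SR s f (sh g) := by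
  intro p q hpq
  have := h p (q - 1) (by omega)
  simp only [sh]
  rwa [show q + 1 - 1 = q - 1 + 1 by ring]

lemma SR.self {f : ℤ → ℝ} (h : SR 0 f f) : SR 1 f f := by
  intro p q hpq
  rcases lt_or_eq_of_le hpq with h1 | rfl
  · exact h p q (by omega)
  · rw [add_sub_cancel_right, mul_comm]

structure ClawInv (a b c v : ℤ → ℝ) : Prop where
  aa : SR 1 a a
  bb : SR 1 b b
  vv : SR 1 v v
  ba : SR 0 b a
  ab : SR 1 a b
  va : SR (-1) v a
  av : SR 2 a v
  vb : SR 0 v b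
  bv : SR 1 b v
  ca : SR (-1) c a

lemma ClawInv.step {a b c v a' v' : ℤ → ℝ} (h : ClawInv a b c v)
    (hv : v' = (12 : ℝ) • sh v + b)
    (ha : a' = (8 : ℝ) • sh a + (32 : ℝ) • sh (sh b) + (24 : ℝ) • sh v')
    (hr : ∀ k, a' k = 20 * a (k - 1) + 24 * b (k - 1) - 64 * b (k - 2) - 384 * c (k - 3)) :
    ClawInv a' a b v' := by
  have vL : ∀ {s : ℤ} {x : ℤ → ℝ}, SR (s - 1) v x → SR s b x → SR s v' x := by
    intro s x h1 h2
    rw [hv]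
    exact (SR.smulL _ (by norm_num) (h1.shL le_rfl)).addL h2
  have vR : ∀ {s : ℤ} {x : ℤ → ℝ}, SR (s + 1) x v → SR s x b → SR s x v' := by
    intro s x h1 h2
    rw [hv]
    exact (SR.smulR _ (by norm_num) (h1.shR le_rfl)).addR h2
  have aL : ∀ {s : ℤ} {x : ℤ → ℝ}, SR (s - 1) a x → SR (s - 2) b x → SR (s - 1) v' x →
      SR s a' x := by
    intro s x h1 h2 h3
    rw [ha]
    exact ((SR.smulL _ (by norm_num) (h1.shL le_rfl)).addL
      (SR.smulL _ (by norm_num) ((h2.shL (s := s - 1) (by omega)).shL le_rfl))).addL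
      (SR.smulL _ (by norm_num) (h3.shL le_rfl))
  have aR : ∀ {s : ℤ} {x : ℤ → ℝ}, SR (s + 1) x a → SR (s + 2) x b → SR (s + 1) x v' →
      SR s x a' := by
    intro s x h1 h2 h3
    rw [ha]
    exact ((SR.smulR _ (by norm_num) (h1.shR le_rfl)).addR
      (SR.smulR _ (by norm_num) ((h2.shR (s := s + 1) (by omega)).shR le_rfl))).addR
      (SR.smulR _ (by norm_num) (h3.shR le_rfl))
  have v'b : SR 1 v' b := vL h.vb h.bb
  have bv' : SR 0 b v' := vR h.bv (h.bb.mono (by norm_num))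
  have v'a : SR 0 v' a := vL h.va h.ba
  have av' : SR 1 a v' := vR h.av h.ab
  have v'v' : SR 1 v' v' := by
    apply SR.self
    apply vL
    · exact vR (h.vv.mono (by norm_num)) (h.vb.mono (by norm_num))
    · exact bv'
  have a'v' : SR 2 a' v' := aL av' bv' v'v'
  have v'a' : SR (-1) v' a' := aR v'a v'b (v'v'.mono (by norm_num))
  have a'a : SR 1 a' a := aL (h.aa.mono (by norm_num)) (h.ba.mono (by norm_num)) v'a
  have aa' : SR 0 a a' := by
    have h0 : SR (-1) a a' := aR (h.aa.mono (by norm_num)) h.ab (av'.mono (by norm_num))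
    intro p q hpq
    rcases lt_or_eq_of_le hpq with h1 | h1
    · exact h0 p q (by omega)
    · have : p = q := by omega
      subst this
      have e1 := h.ab p (p - 1) (by omega)
      have e2 := h.ba (p - 1) (p - 1) (by omega)
      have e3 := h.ca (p - 2) (p - 1) (by omega)
      rw [hr, hr]
      rw [show p + 1 - 1 = p by ring, show p + 1 - 2 = p - 1 by ring,
        show p + 1 - 3 = p - 2 by ring]
      rw [show p - 1 + 1 = p by ring] at e1 e2 e3
      rw [show p - 1 - 1 = p - 2 by ring] at e2
      rw [show p - 2 - 1 = p - 3 by ring] at e3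
      linarith
  have a'b : SR 2 a' b := aL h.ab (h.bb.mono (by norm_num)) v'b
  have a'a' : SR 1 a' a' := SR.self (aR a'a a'b (a'v'.mono (by norm_num)))
  have ba' : SR (-1) b a' := aR h.ba h.bb bv'
  exact ⟨a'a', h.aa, v'v', aa', a'a, v'a', a'v', v'a, av', ba'⟩

def dl (i : ℤ) (x : ℝ) : ℤ → ℝ := fun k => if k = i then x else 0

lemma inv_base : ClawInv (dl 1 40 + dl 2 24) (dl 0 2 + dl 1 2) (dl 0 (1/4)) (dl 0 1) := by
  constructor <;> intro p q hpq <;> simp only [dl, Pi.add_apply] <;> split_ifs <;>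
    first | omega | norm_num

lemma inv_all (a : ℕ → ℤ → ℝ) (h0 : a 0 = dl 0 (1/4)) (h1 : a 1 = dl 0 2 + dl 1 2)
    (h2 : a 2 = dl 1 40 + dl 2 24)
    (hr : ∀ n k, a (n + 3) k = 20 * a (n + 2) (k - 1) + 24 * a (n + 1) (k - 1)
      - 64 * a (n + 1) (k - 2) - 384 * a n (k - 3)) (n : ℕ) :
    ∃ v, ClawInv (a (n + 2)) (a (n + 1)) (a n) v ∧
      a (n + 2) = (8 : ℝ) • sh (a (n + 1)) + (32 : ℝ) • sh (sh (a n)) + (24 : ℝ) • sh v := by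
  induction n with
  | zero =>
    refine ⟨dl 0 1, ?_, ?_⟩
    · simp only [zero_add, h0, h1, h2]
      exact inv_base
    · simp only [zero_add, h0, h1, h2]
      funext k
      simp only [dl, sh, Pi.add_apply, Pi.smul_apply, smul_eq_mul]
      split_ifs <;> first | omega | norm_num
  | succ n ih =>
    obtain ⟨v, hi, he⟩ := ih
    have key : a (n + 3) = (8 : ℝ) • sh (a (n + 2)) + (32 : ℝ) • sh (sh (a (n + 1)))
        + (24 : ℝ) • sh ((12 : ℝ) • sh v + a (n + 1)) := by
      funext k
      have e := congrFun he (k - 1)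
      simp only [sh, Pi.add_apply, Pi.smul_apply, smul_eq_mul] at e ⊢
      rw [hr]
      rw [show k - 1 - 1 - 1 = k - 3 by ring, show k - 1 - 1 = k - 2 by ring] at e
      rw [show k - 1 - 1 = k - 2 by ring]
      linarith
    exact ⟨_, hi.step rfl key (hr n), key⟩

/-- Coefficients of a polynomial, indexed by the integers. -/
noncomputable def zc (P : Polynomial ℝ) : ℤ → ℝ :=
  fun k => if 0 ≤ k then P.coeff k.toNat else 0

lemma zc_X (P : Polynomial ℝ) (k : ℤ) : zc (X * P) k = zc P (k - 1) := by
  unfold zc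
  by_cases hk : 0 ≤ k
  · obtain ⟨m, rfl⟩ := Int.eq_ofNat_of_zero_le hk
    cases m with
    | zero => simp
    | succ m =>
      simp
      intro h
      omega
  · rw [if_neg hk, if_neg (by omega)]

lemma zc_add (P Q : Polynomial ℝ) (k : ℤ) : zc (P + Q) k = zc P k + zc Q k := by
  unfold zc; split_ifs <;> simp

lemma zc_C (c : ℝ) (P : Polynomial ℝ) (k : ℤ) : zc (C c * P) k = c * zc P k := by
  unfold zc; split_ifs <;> simp

lemma zc_one (k : ℤ) : zc 1 k = if k = 0 then 1 else 0 := by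
  unfold zc
  by_cases hk : 0 ≤ k
  · obtain ⟨m, rfl⟩ := Int.eq_ofNat_of_zero_le hk
    simp [coeff_one]
  · rw [if_neg hk, if_neg (by omega)]

theorem stmt15 (Γ : ℕ → Polynomial ℝ)
    (h0 : Γ 0 = 2 + 2 * X) (h1 : Γ 1 = 40 * X + 24 * X ^ 2)
    (h2 : Γ 2 = 48 * X + 720 * X ^ 2 + 256 * X ^ 3)
    (hrec : ∀ n, Γ (n + 3) =
      20 * X * Γ (n + 2) + 8 * X * (3 - 8 * X) * Γ (n + 1) - 384 * X ^ 3 * Γ n) :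
    ∀ n, ∀ i, 1 ≤ i →
      (Γ n).coeff (i - 1) * (Γ n).coeff (i + 1) ≤ ((Γ n).coeff i) ^ 2 := by
  have e0 : Γ 0 = C 2 * 1 + X * (C 2 * 1) := by
    rw [h0]; simp only [map_ofNat]; ring
  have e1 : Γ 1 = X * (C 40 * 1) + X * (X * (C 24 * 1)) := by
    rw [h1]; simp only [map_ofNat]; ring
  have e2 : Γ 2 = X * (C 48 * 1) + X * (X * (C 720 * 1)) + X * (X * (X * (C 256 * 1))) := by
    rw [h2]; simp only [map_ofNat]; ring
  have e3 : ∀ n, Γ (n + 3) = X * (C 20 * Γ (n + 2)) + X * (C 24 * Γ (n + 1))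
      + X * (X * (C (-64) * Γ (n + 1))) + X * (X * (X * (C (-384) * Γ n))) := by
    intro n
    rw [hrec]; simp only [map_ofNat, map_neg]; ring
  let a : ℕ → ℤ → ℝ := fun n => match n with
    | 0 => dl 0 (1/4)
    | n + 1 => zc (Γ n)
  have hr : ∀ n k, a (n + 3) k = 20 * a (n + 2) (k - 1) + 24 * a (n + 1) (k - 1)
      - 64 * a (n + 1) (k - 2) - 384 * a n (k - 3) := by
    intro n k
    match n with
    | 0 =>
      change zc (Γ 2) k = 20 * zc (Γ 1) (k - 1) + 24 * zc (Γ 0) (k - 1)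
        - 64 * zc (Γ 0) (k - 2) - 384 * dl 0 (1/4) (k - 3)
      rw [e0, e1, e2]
      simp only [zc_add, zc_X, zc_C, zc_one, dl]
      split_ifs <;> first | omega | norm_num
    | n + 1 =>
      change zc (Γ (n + 3)) k = 20 * zc (Γ (n + 2)) (k - 1) + 24 * zc (Γ (n + 1)) (k - 1)
        - 64 * zc (Γ (n + 1)) (k - 2) - 384 * zc (Γ n) (k - 3)
      rw [e3]
      simp only [zc_add, zc_X, zc_C]
      rw [show k - 1 - 1 - 1 = k - 3 by ring, show k - 1 - 1 = k - 2 by ring]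
      ring
  have ha1 : a 1 = dl 0 2 + dl 1 2 := by
    funext k
    change zc (Γ 0) k = _
    rw [e0]
    simp only [zc_add, zc_X, zc_C, zc_one, dl, Pi.add_apply]
    split_ifs <;> first | omega | norm_num
  have ha2 : a 2 = dl 1 40 + dl 2 24 := by
    funext k
    change zc (Γ 1) k = _
    rw [e1]
    simp only [zc_add, zc_X, zc_C, zc_one, dl, Pi.add_apply]
    split_ifs <;> first | omega | norm_num
  intro n i hi
  obtain ⟨v, hv, -⟩ := inv_all a rfl ha1 ha2 hr n
  have h : zc (Γ n) ((i : ℤ) - 1) * zc (Γ n) ((i : ℤ) + 1) ≤ zc (Γ n) i * zc (Γ n) i :=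
    hv.bb i i (by omega)
  unfold zc at h
  rw [if_pos (by omega), if_pos (by omega), if_pos (by omega),
    show ((i : ℤ) - 1).toNat = i - 1 by omega, show ((i : ℤ) + 1).toNat = i + 1 by omega,
    Int.toNat_natCast] at h
  rw [sq]
  exact h
end
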